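/- Well-posedness of the modified Smoluchowski equation with limited aggregations: for every initial condition c₀ : S → [0,∞) with 0 < ⟨c₀,a⟩ < ∞, there exists exactly one solution (cₜ)ₜ≥0 of the modified Smoluchowski equation with limited aggregations on [0,∞) with initial condition c₀. -/

import Mathlib

open Set MeasureTheory intervalIntegral

/-- Total concentration of arms ⟨c,a⟩ = ∑_{(a,m) ∈ S} a · c(a,m).
Here a cluster type `p ∈ S = ℕ × ℕ_{≥1}` is encoded as a pair `(a, m) : ℕ × ℕ`
together with the requirement (imposed in the solution predicate below)
that concentrations vanish at mass `m = 0`. -/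
noncomputable def armSum (c : ℕ → ℕ → ℝ) : ℝ := ∑' p : ℕ × ℕ, (p.1 : ℝ) * c p.1 p.2

/-- Gain term (with its 1/2 factor):
(1/2) ∑_{p' ≲ p} (p' · (p∖p')) c(p') c(p∖p'), where for p = (a,m),
p' = (a',m') ranges over a' ≤ a+1, 1 ≤ m' ≤ m-1, and p∖p' = (a+2-a', m-m'). -/
noncomputable def coagGain (c : ℕ → ℕ → ℝ) (a m : ℕ) : ℝ :=
  (1 / 2) * ∑ a' ∈ Finset.range (a + 2), ∑ m' ∈ Finset.Ico 1 m,
    ((a' : ℝ) * ((a + 2 - a' : ℕ) : ℝ)) * c a' m' * c (a + 2 - a') (m - m')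

/-- Loss term: ∑_{p' ∈ S} (p · p') c(p) c(p'). -/
noncomputable def coagLoss (c : ℕ → ℕ → ℝ) (a m : ℕ) : ℝ :=
  ∑' p' : ℕ × ℕ, ((a : ℝ) * (p'.1 : ℝ)) * c a m * c p'.1 p'.2

/-- Solution of the modified Smoluchowski equation with limited aggregations
with initial condition c₀, on [0,∞). -/
def IsModifiedSmoluchowskiSolution (c : ℝ → ℕ → ℕ → ℝ) (c₀ : ℕ → ℕ → ℝ) : Prop :=
  (∀ t ∈ Ici (0:ℝ), ∀ a m : ℕ, 0 ≤ c t a m) ∧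
  (∀ t ∈ Ici (0:ℝ), ∀ a : ℕ, c t a 0 = 0) ∧
  (∀ a m : ℕ, ContinuousOn (fun t => c t a m) (Ici 0)) ∧
  ∀ t ∈ Ici (0:ℝ),
    (0 < sInf ((fun s => armSum (c s)) '' Icc 0 t)) ∧
    BddAbove ((fun s => armSum (c s)) '' Icc 0 t) ∧
    IntervalIntegrable (fun s => (armSum (c s)) ^ 2) volume 0 t ∧
    ∀ a m : ℕ, 1 ≤ m →
      c t a m - c₀ a m =
        ∫ s in (0:ℝ)..t, (armSum (c s))⁻¹ * (coagGain (c s) a m - coagLoss (c s) a m)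

/-- The cluster types `(a, m)` with `a + m ≤ N`. -/
def clusterTriangle (N : ℕ) : Finset (ℕ × ℕ) :=
  (Finset.range (N + 1) ×ˢ Finset.range (N + 1)).filter fun p => p.1 + p.2 ≤ N

lemma mem_clusterTriangle {N : ℕ} {p : ℕ × ℕ} : p ∈ clusterTriangle N ↔ p.1 + p.2 ≤ N := by
  simp only [clusterTriangle, Finset.mem_filter, Finset.mem_product, Finset.mem_range]
  omega

lemma clusterTriangle_mono : Monotone clusterTriangle := fun M N h p hp => by
  rw [mem_clusterTriangle] at hp ⊢
  omega

lemma exists_subset_clusterTriangle (s : Finset (ℕ × ℕ)) : ∃ N, s ⊆ clusterTriangle N :=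
  ⟨s.sup fun p => p.1 + p.2, fun _ hp =>
    mem_clusterTriangle.2 (Finset.le_sup (f := fun p : ℕ × ℕ => p.1 + p.2) hp)⟩

lemma tendsto_clusterTriangle : Filter.Tendsto clusterTriangle Filter.atTop Filter.atTop :=
  Filter.tendsto_atTop_atTop_of_monotone clusterTriangle_mono exists_subset_clusterTriangle

/-- The term of the arm generating function attached to the cluster type `p`. -/
noncomputable def armTerm (b : ℕ → ℕ → ℝ) (x : ℝ) (p : ℕ × ℕ) : ℝ :=
  p.1 * b p.1 p.2 * x ^ (p.1 - 1)

/-- The derivative of `armTerm` in the arm variable. -/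
noncomputable def armDerivTerm (b : ℕ → ℕ → ℝ) (x : ℝ) (p : ℕ × ℕ) : ℝ :=
  p.1 * b p.1 p.2 * ((p.1 - 1 : ℕ) * x ^ (p.1 - 1 - 1))

/-- The arm generating function restricted to the types `(a, m)` with `a + m ≤ N`. -/
noncomputable def armPoly (b : ℕ → ℕ → ℝ) (N : ℕ) (x : ℝ) : ℝ :=
  ∑ p ∈ clusterTriangle N, armTerm b x p

/-- The derivative of `armPoly` in the arm variable. -/
noncomputable def armDerivPoly (b : ℕ → ℕ → ℝ) (N : ℕ) (x : ℝ) : ℝ :=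
  ∑ p ∈ clusterTriangle N, armDerivTerm b x p

lemma armTerm_nonneg {b : ℕ → ℕ → ℝ} (hb : ∀ a m, 0 ≤ b a m) {x : ℝ} (hx : 0 ≤ x) (p : ℕ × ℕ) :
    0 ≤ armTerm b x p := by
  have := hb p.1 p.2
  unfold armTerm
  positivity

lemma armDerivTerm_nonneg {b : ℕ → ℕ → ℝ} (hb : ∀ a m, 0 ≤ b a m) {x : ℝ} (hx : 0 ≤ x)
    (p : ℕ × ℕ) : 0 ≤ armDerivTerm b x p := by
  have := hb p.1 p.2
  unfold armDerivTerm
  positivity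

lemma armTerm_mono {b : ℕ → ℕ → ℝ} (hb : ∀ a m, 0 ≤ b a m) {x y : ℝ} (hx : 0 ≤ x) (hxy : x ≤ y)
    (p : ℕ × ℕ) : armTerm b x p ≤ armTerm b y p :=
  mul_le_mul_of_nonneg_left (pow_le_pow_left₀ hx hxy _) (mul_nonneg (Nat.cast_nonneg _) (hb _ _))

lemma armPoly_nonneg {b : ℕ → ℕ → ℝ} (hb : ∀ a m, 0 ≤ b a m) {x : ℝ} (hx : 0 ≤ x) (N : ℕ) :
    0 ≤ armPoly b N x :=
  Finset.sum_nonneg fun p _ => armTerm_nonneg hb hx p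

lemma armDerivPoly_nonneg {b : ℕ → ℕ → ℝ} (hb : ∀ a m, 0 ≤ b a m) {x : ℝ} (hx : 0 ≤ x) (N : ℕ) :
    0 ≤ armDerivPoly b N x :=
  Finset.sum_nonneg fun p _ => armDerivTerm_nonneg hb hx p

lemma armPoly_mono {b : ℕ → ℕ → ℝ} (hb : ∀ a m, 0 ≤ b a m) {x y : ℝ} (hx : 0 ≤ x) (hxy : x ≤ y)
    (N : ℕ) : armPoly b N x ≤ armPoly b N y :=
  Finset.sum_le_sum fun p _ => armTerm_mono hb hx hxy p

lemma armPoly_monotone {b : ℕ → ℕ → ℝ} (hb : ∀ a m, 0 ≤ b a m) {x : ℝ} (hx : 0 ≤ x) :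
    Monotone fun N => armPoly b N x := fun _ _ h =>
  Finset.sum_le_sum_of_subset_of_nonneg (clusterTriangle_mono h) fun p _ _ => armTerm_nonneg hb hx p

lemma armDerivPoly_monotone {b : ℕ → ℕ → ℝ} (hb : ∀ a m, 0 ≤ b a m) {x : ℝ} (hx : 0 ≤ x) :
    Monotone fun N => armDerivPoly b N x := fun _ _ h =>
  Finset.sum_le_sum_of_subset_of_nonneg (clusterTriangle_mono h)
    fun p _ _ => armDerivTerm_nonneg hb hx p

lemma armPoly_add_mul_armDerivPoly_le {b : ℕ → ℕ → ℝ} (hb : ∀ a m, 0 ≤ b a m) {x δ : ℝ}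
    (hx : 0 ≤ x) (hδ : 0 ≤ δ) (N : ℕ) :
    armPoly b N x + δ * armDerivPoly b N x ≤ armPoly b N (x + δ) := by
  rw [armPoly, armDerivPoly, armPoly, Finset.mul_sum, ← Finset.sum_add_distrib]
  refine Finset.sum_le_sum fun p _ => ?_
  have key : ∀ n : ℕ, x ^ n + δ * (n * x ^ (n - 1)) ≤ (x + δ) ^ n := by
    intro n
    induction n with
    | zero => simp
    | succ n ih =>
      have h1 : (n : ℝ) * x ^ (n - 1) * x = n * x ^ n := by
        rcases n with _ | n
        · simp
        · rw [Nat.add_sub_cancel, pow_succ, mul_assoc]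
      have h2 : 0 ≤ δ * (n * x ^ (n - 1)) * δ := by positivity
      calc x ^ (n + 1) + δ * ((n + 1 : ℕ) * x ^ (n + 1 - 1))
          ≤ (x ^ n + δ * (n * x ^ (n - 1))) * (x + δ) := by
            push_cast
            have : (x ^ n + δ * (n * x ^ (n - 1))) * (x + δ) =
              x ^ (n + 1) + δ * x ^ n + δ * ((n : ℝ) * x ^ (n - 1) * x)
                + δ * (n * x ^ (n - 1)) * δ := by ring
            rw [this, h1]
            nlinarith
        _ ≤ (x + δ) ^ n * (x + δ) := mul_le_mul_of_nonneg_right ih (by positivity)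
        _ = (x + δ) ^ (n + 1) := (pow_succ _ _).symm
  have hw : 0 ≤ (p.1 : ℝ) * b p.1 p.2 := mul_nonneg (Nat.cast_nonneg _) (hb _ _)
  have := mul_le_mul_of_nonneg_left (key (p.1 - 1)) hw
  simp only [armTerm, armDerivTerm]
  linarith

/-- The arm generating function of the gain terms, restricted to the types with `a + m ≤ N`. -/
noncomputable def gainPoly (b : ℕ → ℕ → ℝ) (N : ℕ) (x : ℝ) : ℝ :=
  ∑ p ∈ clusterTriangle N, armTerm (coagGain b) x p

/-- The ordered pairs of cluster types whose aggregate lies in `clusterTriangle N`. -/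
def aggregatingPairs (N : ℕ) : Finset ((ℕ × ℕ) × (ℕ × ℕ)) :=
  (clusterTriangle N ×ˢ clusterTriangle N).filter fun u =>
    1 ≤ u.1.1 ∧ 1 ≤ u.2.1 ∧ 1 ≤ u.1.2 ∧ 1 ≤ u.2.2 ∧ u.1.1 + u.2.1 + (u.1.2 + u.2.2) ≤ N + 2

lemma mem_aggregatingPairs {N : ℕ} {u : (ℕ × ℕ) × (ℕ × ℕ)} : u ∈ aggregatingPairs N ↔
    1 ≤ u.1.1 ∧ 1 ≤ u.2.1 ∧ 1 ≤ u.1.2 ∧ 1 ≤ u.2.2 ∧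
      u.1.1 + u.2.1 + (u.1.2 + u.2.2) ≤ N + 2 := by
  simp only [aggregatingPairs, Finset.mem_filter, Finset.mem_product, mem_clusterTriangle]
  omega

/-- The contribution of an ordered pair of cluster types to the gain generating function. -/
noncomputable def pairTerm (b : ℕ → ℕ → ℝ) (x : ℝ) (u : (ℕ × ℕ) × (ℕ × ℕ)) : ℝ :=
  1 / 2 * (armTerm b x u.1 * armDerivTerm b x u.2 + armDerivTerm b x u.1 * armTerm b x u.2)

lemma pairTerm_nonneg {b : ℕ → ℕ → ℝ} (hb : ∀ a m, 0 ≤ b a m) {x : ℝ} (hx : 0 ≤ x)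
    (u : (ℕ × ℕ) × (ℕ × ℕ)) : 0 ≤ pairTerm b x u :=
  mul_nonneg (by norm_num) (add_nonneg
    (mul_nonneg (armTerm_nonneg hb hx _) (armDerivTerm_nonneg hb hx _))
    (mul_nonneg (armDerivTerm_nonneg hb hx _) (armTerm_nonneg hb hx _)))

lemma sum_pairTerm (b : ℕ → ℕ → ℝ) (x : ℝ) (N : ℕ) :
    ∑ u ∈ clusterTriangle N ×ˢ clusterTriangle N, pairTerm b x u =
      armPoly b N x * armDerivPoly b N x := by
  simp only [pairTerm, ← Finset.mul_sum, Finset.sum_add_distrib, Finset.sum_product]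
  simp only [← Finset.sum_mul]
  simp only [armPoly, armDerivPoly]
  ring

lemma pairTerm_eq (b : ℕ → ℕ → ℝ) (x : ℝ) {i j k l : ℕ} (hi : 1 ≤ i) (hj : 1 ≤ j) :
    pairTerm b x ((i, k), (j, l)) =
      1 / 2 * ((i + j - 2 : ℕ) * (i * j * b i k * b j l) * x ^ (i + j - 2 - 1)) := by
  obtain ⟨i, rfl⟩ := Nat.exists_eq_add_of_le' hi
  obtain ⟨j, rfl⟩ := Nat.exists_eq_add_of_le' hj
  have h : ((i + j : ℕ) : ℝ) * x ^ (i + j - 1) =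
      x ^ i * (j * x ^ (j - 1)) + i * x ^ (i - 1) * x ^ j := by
    rcases i with _ | i
    · simp
    rcases j with _ | j
    · simp
    rw [show i + 1 + (j + 1) - 1 = i + j + 1 by omega]
    push_cast
    ring
  simp only [pairTerm, armTerm, armDerivTerm, Nat.add_sub_cancel,
    show i + 1 + (j + 1) - 2 = i + j by omega]
  linear_combination (-1 / 2 : ℝ) * ((i + 1 : ℕ) * (j + 1 : ℕ) * b (i + 1) k * b (j + 1) l) * h

lemma gainPoly_eq_sum_pairTerm (b : ℕ → ℕ → ℝ) (N : ℕ) (x : ℝ) :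
    gainPoly b N x = ∑ u ∈ aggregatingPairs N, pairTerm b x u := by
  have h1 : gainPoly b N x = ∑ v ∈ (clusterTriangle N).sigma
      (fun p => (Finset.range (p.1 + 2) ×ˢ Finset.Ico 1 p.2).filter fun q => 1 ≤ q.1),
      1 / 2 * ((v.1.1 : ℝ) * (v.2.1 * (v.1.1 + 2 - v.2.1 : ℕ) * b v.2.1 v.2.2 *
        b (v.1.1 + 2 - v.2.1) (v.1.2 - v.2.2)) * x ^ (v.1.1 - 1)) := by
    rw [gainPoly, Finset.sum_sigma]
    refine Finset.sum_congr rfl fun p _ => ?_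
    rw [Finset.sum_filter_of_ne, Finset.sum_product]
    · simp only [armTerm, coagGain, Finset.mul_sum, Finset.sum_mul]
      refine Finset.sum_congr rfl fun i _ => Finset.sum_congr rfl fun k _ => ?_
      ring
    · intro q _ hq
      by_contra h0
      exact hq (by simp [show q.1 = 0 by omega])
  rw [h1]
  refine Finset.sum_nbij' (fun v => (v.2, (v.1.1 + 2 - v.2.1, v.1.2 - v.2.2)))
    (fun u => ⟨(u.1.1 + u.2.1 - 2, u.1.2 + u.2.2), u.1⟩) ?_ ?_ ?_ ?_ ?_
  · rintro ⟨⟨a, m⟩, ⟨i, k⟩⟩ h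
    simp only [Finset.mem_sigma, mem_clusterTriangle, Finset.mem_filter, Finset.mem_product,
      Finset.mem_range, Finset.mem_Ico, mem_aggregatingPairs] at h ⊢
    omega
  · rintro ⟨⟨i, k⟩, ⟨j, l⟩⟩ h
    simp only [Finset.mem_sigma, mem_clusterTriangle, Finset.mem_filter, Finset.mem_product,
      Finset.mem_range, Finset.mem_Ico, mem_aggregatingPairs] at h ⊢
    omega
  · rintro ⟨⟨a, m⟩, ⟨i, k⟩⟩ h
    simp only [Finset.mem_sigma, mem_clusterTriangle, Finset.mem_filter, Finset.mem_product,
      Finset.mem_range, Finset.mem_Ico] at h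
    rw [show i + (a + 2 - i) - 2 = a by omega, show k + (m - k) = m by omega]
  · rintro ⟨⟨i, k⟩, ⟨j, l⟩⟩ h
    simp only [mem_aggregatingPairs] at h
    simp only [Prod.mk.injEq, true_and]
    omega
  · rintro ⟨⟨a, m⟩, ⟨i, k⟩⟩ h
    simp only [Finset.mem_sigma, mem_clusterTriangle, Finset.mem_filter, Finset.mem_product,
      Finset.mem_range, Finset.mem_Ico] at h
    simp only
    rw [pairTerm_eq b x (by omega) (by omega), show i + (a + 2 - i) - 2 = a by omega]

lemma gainPoly_le {b : ℕ → ℕ → ℝ} (hb : ∀ a m, 0 ≤ b a m) {x : ℝ} (hx : 0 ≤ x) (N : ℕ) :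
    gainPoly b N x ≤ armPoly b N x * armDerivPoly b N x := by
  rw [gainPoly_eq_sum_pairTerm, ← sum_pairTerm]
  exact Finset.sum_le_sum_of_subset_of_nonneg (Finset.filter_subset _ _)
    fun u _ _ => pairTerm_nonneg hb hx u

lemma le_gainPoly {b : ℕ → ℕ → ℝ} (hb : ∀ a m, 0 ≤ b a m) (hb0 : ∀ a, b a 0 = 0) {x : ℝ}
    (hx : 0 ≤ x) (N : ℕ) :
    armPoly b N x * armDerivPoly b N x ≤ gainPoly b (2 * N) x := by
  rw [gainPoly_eq_sum_pairTerm, ← sum_pairTerm,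
    ← Finset.sum_filter_of_ne (p := fun u => 1 ≤ u.1.1 ∧ 1 ≤ u.2.1 ∧ 1 ≤ u.1.2 ∧ 1 ≤ u.2.2)]
  · refine Finset.sum_le_sum_of_subset_of_nonneg ?_ fun u _ _ => pairTerm_nonneg hb hx u
    intro u
    simp only [Finset.mem_filter, Finset.mem_product, mem_clusterTriangle, mem_aggregatingPairs]
    omega
  · rintro ⟨⟨i, k⟩, ⟨j, l⟩⟩ _ h
    by_contra hc
    have h0 : i = 0 ∨ j = 0 ∨ k = 0 ∨ l = 0 := by
      simp only at hc
      omega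
    apply h
    rcases h0 with rfl | rfl | rfl | rfl <;> simp [pairTerm, armTerm, armDerivTerm, hb0]

/-- The solution of `dB/dθ = coagGain B` with initial value `c₀`, by recursion on the mass. -/
noncomputable def gainFlowAux (c₀ : ℕ → ℕ → ℝ) : ℕ → ℕ → ℝ → ℝ
  | m, a, θ => c₀ a m + ∫ r in (0 : ℝ)..θ,
      (1 / 2) * ∑ a' ∈ Finset.range (a + 2), ∑ m' ∈ (Finset.Ico 1 m).attach,
        ((a' : ℝ) * ((a + 2 - a' : ℕ) : ℝ)) * gainFlowAux c₀ m'.1 a' r *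
          gainFlowAux c₀ (m - m'.1) (a + 2 - a') r
  termination_by m => m
  decreasing_by
    · have := Finset.mem_Ico.1 m'.2
      omega
    · have := Finset.mem_Ico.1 m'.2
      omega

/-- The flow of the gain operator `coagGain` started at `c₀`. -/
noncomputable def gainFlow (c₀ : ℕ → ℕ → ℝ) (θ : ℝ) (a m : ℕ) : ℝ := gainFlowAux c₀ m a θ

lemma gainFlow_eq (c₀ : ℕ → ℕ → ℝ) (θ : ℝ) (a m : ℕ) :
    gainFlow c₀ θ a m = c₀ a m + ∫ r in (0 : ℝ)..θ, coagGain (gainFlow c₀ r) a m := by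
  rw [gainFlow, gainFlowAux]
  congr 2
  ext r
  rw [coagGain]
  congr 1
  refine Finset.sum_congr rfl fun a' _ => ?_
  rw [← Finset.sum_attach (Finset.Ico 1 m)]
  rfl

lemma continuous_coagGain_of_lt {β : Type*} [TopologicalSpace β] {b : β → ℕ → ℕ → ℝ} {m : ℕ}
    {s : Set β} (hb : ∀ m' < m, ∀ a, ContinuousOn (fun r => b r a m') s) (a : ℕ) :
    ContinuousOn (fun r => coagGain (b r) a m) s := by
  unfold coagGain
  refine ContinuousOn.mul continuousOn_const ?_
  refine continuousOn_finsetSum _ fun a' _ => continuousOn_finsetSum _ fun m' hm' => ?_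
  rw [Finset.mem_Ico] at hm'
  exact (continuousOn_const.mul (hb _ (by omega) _)).mul (hb _ (by omega) _)

lemma continuous_gainFlow (c₀ : ℕ → ℕ → ℝ) (a m : ℕ) :
    Continuous fun θ => gainFlow c₀ θ a m := by
  induction m using Nat.strong_induction_on generalizing a with
  | _ m ih =>
    have h : Continuous fun r => coagGain (gainFlow c₀ r) a m := by
      rw [← continuousOn_univ]
      exact continuous_coagGain_of_lt (fun m' hm' a => (ih m' hm' a).continuousOn) a
    simp only [gainFlow_eq c₀ _ a m]
    exact continuous_const.add (intervalIntegral.continuous_primitive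
      (fun _ _ => h.intervalIntegrable _ _) 0)

lemma continuous_coagGain_gainFlow (c₀ : ℕ → ℕ → ℝ) (a m : ℕ) :
    Continuous fun θ => coagGain (gainFlow c₀ θ) a m := by
  rw [← continuousOn_univ]
  exact continuous_coagGain_of_lt (fun m' _ a => (continuous_gainFlow c₀ a m').continuousOn) a

lemma hasDerivAt_gainFlow (c₀ : ℕ → ℕ → ℝ) (a m : ℕ) (θ : ℝ) :
    HasDerivAt (fun r => gainFlow c₀ r a m) (coagGain (gainFlow c₀ θ) a m) θ := by
  simp only [gainFlow_eq c₀ _ a m]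
  have h := continuous_coagGain_gainFlow c₀ a m
  exact (intervalIntegral.integral_hasDerivAt_right (h.intervalIntegrable _ _)
    (h.stronglyMeasurableAtFilter _ _) h.continuousAt).const_add _

lemma contDiff_gainFlow (c₀ : ℕ → ℕ → ℝ) (a m : ℕ) :
    ContDiff ℝ 1 fun θ => gainFlow c₀ θ a m := by
  rw [contDiff_one_iff_deriv]
  refine ⟨fun θ => (hasDerivAt_gainFlow c₀ a m θ).differentiableAt, ?_⟩
  rw [show deriv (fun θ => gainFlow c₀ θ a m) = fun θ => coagGain (gainFlow c₀ θ) a m from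
    funext fun θ => (hasDerivAt_gainFlow c₀ a m θ).deriv]
  exact continuous_coagGain_gainFlow c₀ a m

lemma coagGain_nonneg_of_lt {b : ℕ → ℕ → ℝ} {m : ℕ} (hb : ∀ m' < m, ∀ a, 0 ≤ b a m') (a : ℕ) :
    0 ≤ coagGain b a m := by
  refine mul_nonneg (by norm_num) (Finset.sum_nonneg fun a' _ => Finset.sum_nonneg fun m' hm' => ?_)
  rw [Finset.mem_Ico] at hm'
  exact mul_nonneg (mul_nonneg (by positivity) (hb _ (by omega) _)) (hb _ (by omega) _)

lemma coagGain_zero_right (b : ℕ → ℕ → ℝ) (a : ℕ) : coagGain b a 0 = 0 := by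
  simp [coagGain]

lemma gainFlow_zero (c₀ : ℕ → ℕ → ℝ) : gainFlow c₀ 0 = c₀ := by
  ext a m
  simp [gainFlow_eq]

lemma gainFlow_mass_zero {c₀ : ℕ → ℕ → ℝ} (h₀ : ∀ a, c₀ a 0 = 0) (θ : ℝ) (a : ℕ) :
    gainFlow c₀ θ a 0 = 0 := by
  simp [gainFlow_eq, coagGain_zero_right, h₀]

lemma gainFlow_nonneg {c₀ : ℕ → ℕ → ℝ} (h₀ : ∀ a m, 0 ≤ c₀ a m) {θ : ℝ} (hθ : 0 ≤ θ) (a m : ℕ) :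
    0 ≤ gainFlow c₀ θ a m := by
  induction m using Nat.strong_induction_on generalizing a θ with
  | _ m ih =>
    rw [gainFlow_eq]
    refine add_nonneg (h₀ a m) (intervalIntegral.integral_nonneg hθ fun r hr => ?_)
    exact coagGain_nonneg_of_lt (fun m' hm' a => ih m' hm' hr.1 a) a

lemma gainFlow_mono {c₀ : ℕ → ℕ → ℝ} (h₀ : ∀ a m, 0 ≤ c₀ a m) {θ θ' : ℝ} (hθ : 0 ≤ θ)
    (h : θ ≤ θ') (a m : ℕ) : gainFlow c₀ θ a m ≤ gainFlow c₀ θ' a m := by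
  refine monotoneOn_of_deriv_nonneg (convex_Ici (0 : ℝ))
    (continuous_gainFlow c₀ a m).continuousOn
    (contDiff_gainFlow c₀ a m).differentiable_one.differentiableOn ?_ hθ (hθ.trans h) h
  intro r hr
  rw [interior_Ici] at hr
  rw [(hasDerivAt_gainFlow c₀ a m r).deriv]
  exact coagGain_nonneg_of_lt (fun m' _ a => gainFlow_nonneg h₀ (le_of_lt hr) a m') a

lemma hasDerivAt_armPoly_gainFlow (c₀ : ℕ → ℕ → ℝ) (N : ℕ) (z v θ : ℝ) :
    HasDerivAt (fun r => armPoly (gainFlow c₀ r) N (z - r * v))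
      (gainPoly (gainFlow c₀ θ) N (z - θ * v) -
        v * armDerivPoly (gainFlow c₀ θ) N (z - θ * v)) θ := by
  simp only [armPoly, gainPoly, armDerivPoly, Finset.mul_sum, ← Finset.sum_sub_distrib]
  refine HasDerivAt.fun_sum fun p _ => ?_
  have h1 : HasDerivAt (fun r : ℝ => z - r * v) (-v) θ := by
    simpa using ((hasDerivAt_id θ).mul_const v).const_sub z
  have h2 := ((hasDerivAt_gainFlow c₀ p.1 p.2 θ).const_mul (p.1 : ℝ)).mul (h1.pow (p.1 - 1))
  convert! h2 using 1
  simp only [armTerm, armDerivTerm, Pi.pow_apply]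
  ring

lemma continuous_armDerivPoly_gainFlow (c₀ : ℕ → ℕ → ℝ) (N : ℕ) (z v : ℝ) :
    Continuous fun r => armDerivPoly (gainFlow c₀ r) N (z - r * v) := by
  have := continuous_gainFlow c₀
  unfold armDerivPoly armDerivTerm
  fun_prop

lemma continuous_gainPoly_gainFlow (c₀ : ℕ → ℕ → ℝ) (N : ℕ) (z v : ℝ) :
    Continuous fun r => gainPoly (gainFlow c₀ r) N (z - r * v) := by
  have := continuous_coagGain_gainFlow c₀
  unfold gainPoly armTerm
  fun_prop

/-- The generating function of the gain flow is bounded along characteristics by its initial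
value. -/
lemma armPoly_gainFlow_le {c₀ : ℕ → ℕ → ℝ} (h₀ : ∀ a m, 0 ≤ c₀ a m) {N : ℕ} {z v θ : ℝ}
    (hv0 : 0 ≤ v) (hv : armPoly c₀ N z ≤ v) (hθ : 0 ≤ θ) (hz : 0 ≤ z - θ * v) :
    armPoly (gainFlow c₀ θ) N (z - θ * v) ≤ v := by
  set L : ℝ → ℝ := fun r => armDerivPoly (gainFlow c₀ r) N (z - r * v)
  have hL : Continuous L := continuous_armDerivPoly_gainFlow c₀ N z v
  set E : ℝ → ℝ := fun r =>
    (armPoly (gainFlow c₀ r) N (z - r * v) - v) * Real.exp (-∫ u in (0 : ℝ)..r, L u)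
  have hE : ∀ r, HasDerivAt E ((gainPoly (gainFlow c₀ r) N (z - r * v) - v * L r) *
      Real.exp (-∫ u in (0 : ℝ)..r, L u) + (armPoly (gainFlow c₀ r) N (z - r * v) - v) *
      (Real.exp (-∫ u in (0 : ℝ)..r, L u) * (-L r))) r := fun r =>
    ((hasDerivAt_armPoly_gainFlow c₀ N z v r).sub_const v).mul
      ((intervalIntegral.integral_hasDerivAt_right (hL.intervalIntegrable _ _)
        (hL.stronglyMeasurableAtFilter _ _) hL.continuousAt).fun_neg.exp)
  have hanti : AntitoneOn E (Icc 0 θ) := by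
    refine antitoneOn_of_deriv_nonpos (convex_Icc 0 θ)
      (fun r _ => (hE r).continuousAt.continuousWithinAt)
      (fun r _ => (hE r).differentiableAt.differentiableWithinAt) fun r hr => ?_
    rw [interior_Icc] at hr
    rw [(hE r).deriv]
    have hx : 0 ≤ z - r * v := hz.trans (by nlinarith [hr.2])
    have hle := gainPoly_le (fun a m => gainFlow_nonneg h₀ hr.1.le a m) hx N
    have he := Real.exp_pos (-∫ u in (0 : ℝ)..r, L u)
    have : (gainPoly (gainFlow c₀ r) N (z - r * v) -
      armPoly (gainFlow c₀ r) N (z - r * v) * L r) *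
      Real.exp (-∫ u in (0 : ℝ)..r, L u) ≤ 0 :=
      mul_nonpos_of_nonpos_of_nonneg (by simpa [L] using hle) he.le
    linarith
  have h := hanti ⟨le_rfl, hθ⟩ ⟨hθ, le_rfl⟩ hθ
  simp only [E, intervalIntegral.integral_same, neg_zero, Real.exp_zero, mul_one, zero_mul,
    sub_zero, gainFlow_zero] at h
  have he := Real.exp_pos (-∫ u in (0 : ℝ)..θ, L u)
  by_contra! hc
  nlinarith [mul_pos (sub_pos.2 hc) he]

/-- A bounded function dominated by a multiple of its own primitive is nonpositive. -/
lemma nonpos_of_le_integral {f g : ℝ → ℝ} {K M T : ℝ} (hK : 0 ≤ K) (hM : 0 ≤ M)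
    (hf0 : ∀ r ∈ Icc 0 T, 0 ≤ f r)
    (hfM : ∀ r ∈ Icc 0 T, f r ≤ M) (hg : ∀ r ∈ Icc 0 T, g r ≤ K)
    (h : ∀ r ∈ Icc 0 T, f r ≤ ∫ u in (0 : ℝ)..r, f u * g u) {r : ℝ} (hr : r ∈ Icc 0 T) :
    f r ≤ 0 := by
  have key : ∀ n : ℕ, ∀ r ∈ Icc 0 T, f r ≤ M * ((K * r) ^ n / n.factorial) := by
    intro n
    induction n with
    | zero => simpa using hfM
    | succ n ih =>
      intro r hr
      have hpos : 0 ≤ M * ((K * r) ^ (n + 1) / (n + 1).factorial) := by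
        have := hr.1
        positivity
      refine (h r hr).trans ?_
      by_cases hi : IntervalIntegrable (fun u => f u * g u) volume 0 r
      · have hpow : ∫ u in (0 : ℝ)..r, M * ((K * u) ^ n / n.factorial) * K =
            M * ((K * r) ^ (n + 1) / (n + 1).factorial) := by
          have : ∀ u : ℝ, M * ((K * u) ^ n / n.factorial) * K =
              (M * K ^ (n + 1) / n.factorial) * u ^ n := fun u => by
            rw [mul_pow]
            ring
          simp only [this]
          rw [intervalIntegral.integral_const_mul, integral_pow, Nat.factorial_succ]
          push_cast
          have h1 : (n.factorial : ℝ) ≠ 0 := by positivity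
          have h2 : ((n : ℝ) + 1) ≠ 0 := by positivity
          simp only [ne_eq, Nat.add_eq_zero_iff, one_ne_zero, and_false, not_false_eq_true,
            zero_pow, sub_zero]
          field_simp
          ring
        rw [← hpow]
        refine intervalIntegral.integral_mono_on hr.1 hi
          (Continuous.intervalIntegrable (by fun_prop) _ _) fun u hu => ?_
        have huT : u ∈ Icc 0 T := ⟨hu.1, hu.2.trans hr.2⟩
        exact (mul_le_mul_of_nonneg_left (hg u huT) (hf0 u huT)).trans
          (mul_le_mul_of_nonneg_right (ih u huT) hK)
      · rw [intervalIntegral.integral_undef hi]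
        exact hpos
  have hlim : Filter.Tendsto (fun n : ℕ => M * ((K * r) ^ n / n.factorial)) Filter.atTop
      (nhds (M * 0)) := (FloorSemiring.tendsto_pow_div_factorial_atTop (K * r)).const_mul M
  rw [mul_zero] at hlim
  exact ge_of_tendsto' hlim fun n => key n r hr

/-- The generating function of the gain flow is constant along characteristics up to the time at
which they meet. -/
lemma tendsto_armPoly_gainFlow {c₀ : ℕ → ℕ → ℝ} (h₀ : ∀ a m, 0 ≤ c₀ a m) (h₀' : ∀ a, c₀ a 0 = 0)
    {z l v w T : ℝ} (hv0 : 0 ≤ v)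
    (hv : Filter.Tendsto (fun N => armPoly c₀ N z) Filter.atTop (nhds v))
    (hvw : v ≤ w) (hw : ∀ N, armPoly c₀ N l ≤ w) (hT : 0 ≤ T) (hz : 0 ≤ z - T * v)
    (hgap : z - T * v < l - T * w) :
    Filter.Tendsto (fun N => armPoly (gainFlow c₀ T) N (z - T * v)) Filter.atTop (nhds v) := by
  have hb : ∀ r ∈ Icc 0 T, ∀ a m, 0 ≤ gainFlow c₀ r a m := fun r hr => gainFlow_nonneg h₀ hr.1
  have hx : ∀ r ∈ Icc 0 T, 0 ≤ z - r * v := fun r hr => by nlinarith [hr.2]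
  have hz0 : 0 ≤ z := by simpa using hx 0 ⟨le_rfl, hT⟩
  have hvN : ∀ N, armPoly c₀ N z ≤ v := (armPoly_monotone h₀ hz0).ge_of_tendsto hv
  set δ := (l - T * w) - (z - T * v) with hδ
  have hδ0 : 0 < δ := by linarith
  set F : ℕ → ℝ → ℝ := fun N r => armPoly (gainFlow c₀ r) N (z - r * v) with hF
  set Q : ℕ → ℝ → ℝ := fun N r => armDerivPoly (gainFlow c₀ r) N (z - r * v) with hQ
  set P : ℕ → ℝ → ℝ := fun N r => gainPoly (gainFlow c₀ r) N (z - r * v) with hP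
  have hFv : ∀ N, ∀ r ∈ Icc 0 T, F N r ≤ v := fun N r hr =>
    armPoly_gainFlow_le h₀ hv0 (hvN N) hr.1 (hx r hr)
  have hF0 : ∀ N, ∀ r ∈ Icc 0 T, 0 ≤ F N r := fun N r hr => armPoly_nonneg (hb r hr) (hx r hr) N
  have hQ0 : ∀ N, ∀ r ∈ Icc 0 T, 0 ≤ Q N r := fun N r hr =>
    armDerivPoly_nonneg (hb r hr) (hx r hr) N
  set K := w / δ with hKdef
  have hQK : ∀ N, ∀ r ∈ Icc 0 T, Q N r ≤ K := by
    intro N r hr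
    have h1 := armPoly_add_mul_armDerivPoly_le (hb r hr) (hx r hr) hδ0.le N
    have h2 : z - r * v + δ ≤ l - r * w := by
      rw [hδ]
      nlinarith [mul_nonneg (sub_nonneg.2 hr.2) (sub_nonneg.2 hvw)]
    have h3 := armPoly_mono (hb r hr) (add_nonneg (hx r hr) hδ0.le) h2 N
    have h4 := armPoly_gainFlow_le h₀ (hv0.trans hvw) (hw N) hr.1
      ((add_nonneg (hx r hr) hδ0.le).trans h2)
    have h5 := hF0 N r hr
    rw [hKdef, le_div_iff₀ hδ0]
    simp only [hF, hQ] at h5 ⊢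
    linarith
  have hK0 : 0 ≤ K := div_nonneg (hv0.trans hvw) hδ0.le
  set Fi : ℝ → ℝ := fun r => ⨆ N, F N r
  set Qi : ℝ → ℝ := fun r => ⨆ N, Q N r with hQi
  have hFt : ∀ r ∈ Icc 0 T, Filter.Tendsto (fun N => F N r) Filter.atTop (nhds (Fi r)) :=
    fun r hr => tendsto_atTop_ciSup (armPoly_monotone (hb r hr) (hx r hr))
      ⟨v, by rintro _ ⟨N, rfl⟩; exact hFv N r hr⟩
  have hQt : ∀ r ∈ Icc 0 T, Filter.Tendsto (fun N => Q N r) Filter.atTop (nhds (Qi r)) :=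
    fun r hr => tendsto_atTop_ciSup (armDerivPoly_monotone (hb r hr) (hx r hr))
      ⟨K, by rintro _ ⟨N, rfl⟩; exact hQK N r hr⟩
  have h2 : Filter.Tendsto (fun N : ℕ => 2 * N) Filter.atTop Filter.atTop :=
    Filter.tendsto_id.const_mul_atTop' (by norm_num)
  have hPt : ∀ r ∈ Icc 0 T, Filter.Tendsto (fun N => P (2 * N) r) Filter.atTop
      (nhds (Fi r * Qi r)) := fun r hr =>
    tendsto_of_tendsto_of_tendsto_of_le_of_le ((hFt r hr).mul (hQt r hr))
      (((hFt r hr).mul (hQt r hr)).comp h2)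
      (fun N => le_gainPoly (hb r hr) (gainFlow_mass_zero h₀' r) (hx r hr) N)
      (fun N => gainPoly_le (hb r hr) (hx r hr) (2 * N))
  have hPb : ∀ N, ∀ r ∈ Icc 0 T, ‖P N r - v * Q N r‖ ≤ v * K := by
    intro N r hr
    have h1 : 0 ≤ P N r := Finset.sum_nonneg fun p _ => armTerm_nonneg
      (fun a m => coagGain_nonneg_of_lt (fun m' _ a => hb r hr a m') a) (hx r hr) p
    have h3 : P N r ≤ v * K := (gainPoly_le (hb r hr) (hx r hr) N).trans
      (mul_le_mul (hFv N r hr) (hQK N r hr) (hQ0 N r hr) hv0)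
    have h4 : v * Q N r ≤ v * K := mul_le_mul_of_nonneg_left (hQK N r hr) hv0
    have h5 : 0 ≤ v * Q N r := mul_nonneg hv0 (hQ0 N r hr)
    rw [Real.norm_eq_abs, abs_le]
    constructor <;> linarith
  have hFTC : ∀ N r, ∫ u in (0 : ℝ)..r, (P N u - v * Q N u) = F N r - armPoly c₀ N z := by
    intro N r
    rw [intervalIntegral.integral_eq_sub_of_hasDerivAt
      (fun u _ => hasDerivAt_armPoly_gainFlow c₀ N z v u)]
    · simp [hF, gainFlow_zero]
    · exact ((continuous_gainPoly_gainFlow c₀ N z v).sub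
        ((continuous_armDerivPoly_gainFlow c₀ N z v).const_mul v)).intervalIntegrable _ _
  have hFTi : ∀ r ∈ Icc 0 T, Fi r - v = ∫ u in (0 : ℝ)..r, (Fi u * Qi u - v * Qi u) := by
    intro r hr
    have hsub : ∀ u ∈ uIoc 0 r, u ∈ Icc 0 T := fun u hu => by
      rw [uIoc_of_le hr.1] at hu
      exact ⟨hu.1.le, hu.2.trans hr.2⟩
    have hlim := intervalIntegral.tendsto_integral_filter_of_dominated_convergence
      (μ := volume) (a := 0) (b := r) (l := Filter.atTop)
      (F := fun N u => P (2 * N) u - v * Q (2 * N) u)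
      (f := fun u => Fi u * Qi u - v * Qi u) (fun _ => v * K)
      (Filter.Eventually.of_forall fun N =>
        ((continuous_gainPoly_gainFlow c₀ (2 * N) z v).sub
          ((continuous_armDerivPoly_gainFlow c₀ (2 * N) z v).const_mul v)).aestronglyMeasurable)
      (Filter.Eventually.of_forall fun N => Filter.Eventually.of_forall fun u hu =>
        hPb _ u (hsub u hu))
      intervalIntegrable_const
      (Filter.Eventually.of_forall fun u hu =>
        (hPt u (hsub u hu)).sub (((hQt u (hsub u hu)).comp h2).const_mul v))
    refine tendsto_nhds_unique ?_ hlim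
    simp only [hFTC]
    exact ((hFt r hr).comp h2).sub (hv.comp h2)
  have hFiv : ∀ r ∈ Icc 0 T, Fi r ≤ v := fun r hr => le_of_tendsto' (hFt r hr) (hFv · r hr)
  have hFi0 : ∀ r ∈ Icc 0 T, 0 ≤ Fi r := fun r hr => ge_of_tendsto' (hFt r hr) (hF0 · r hr)
  have hTT : T ∈ Icc 0 T := ⟨hT, le_rfl⟩
  have hfin := nonpos_of_le_integral (f := fun r => v - Fi r) (g := Qi) hK0 hv0
    (fun r hr => sub_nonneg.2 (hFiv r hr)) (fun r hr => by linarith [hFi0 r hr])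
    (fun r hr => le_of_tendsto' (hQt r hr) (hQK · r hr))
    (fun r hr => by
      have h1 : ∫ u in (0 : ℝ)..r, (v - Fi u) * Qi u =
          -∫ u in (0 : ℝ)..r, (Fi u * Qi u - v * Qi u) := by
        rw [← intervalIntegral.integral_neg]
        congr 1
        ext u
        ring
      rw [h1, ← hFTi r hr]
      simp) hTT
  have heq : Fi T = v := le_antisymm (hFiv T hTT) (by simpa using hfin)
  have hlim := hFt T hTT
  rwa [heq] at hlim

lemma coagGain_congr_of_lt {b b' : ℕ → ℕ → ℝ} {m : ℕ} (h : ∀ m' < m, ∀ a, b a m' = b' a m')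
    (a : ℕ) : coagGain b a m = coagGain b' a m := by
  unfold coagGain
  congr 1
  refine Finset.sum_congr rfl fun a' _ => Finset.sum_congr rfl fun m' hm' => ?_
  rw [Finset.mem_Ico] at hm'
  rw [h m' (by omega), h (m - m') (by omega)]

lemma coagGain_exp_mul (b : ℕ → ℕ → ℝ) (t : ℝ) (a m : ℕ) :
    coagGain (fun a m => Real.exp (-(a * t)) * b a m) a m =
      Real.exp (-(a * t)) * Real.exp (-(2 * t)) * coagGain b a m := by
  unfold coagGain
  simp only [Finset.mul_sum]
  refine Finset.sum_congr rfl fun a' ha' => Finset.sum_congr rfl fun m' _ => ?_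
  rw [Finset.mem_range] at ha'
  have h : Real.exp (-(a * t)) * Real.exp (-(2 * t)) =
      Real.exp (-(a' * t)) * Real.exp (-((a + 2 - a' : ℕ) * t)) := by
    rw [← Real.exp_add, ← Real.exp_add, Nat.cast_sub (by omega)]
    push_cast
    ring_nf
  rw [h]
  ring

lemma coagLoss_eq (b : ℕ → ℕ → ℝ) (a m : ℕ) : coagLoss b a m = a * b a m * armSum b := by
  rw [coagLoss, armSum, ← tsum_mul_left]
  congr 1
  ext p
  ring

lemma absolutelyContinuous_gainFlow_comp (c₀ : ℕ → ℕ → ℝ) (a m : ℕ) {θ : ℝ → ℝ} {K : NNReal}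
    {T : ℝ} (hθ : LipschitzOnWith K θ (uIcc 0 T)) :
    AbsolutelyContinuousOnInterval (fun t => gainFlow c₀ (θ t) a m) 0 T := by
  obtain ⟨R, hR⟩ :=
    (isCompact_uIcc.image_of_continuousOn hθ.continuousOn).isBounded.subset_closedBall 0
  obtain ⟨K', hK'⟩ := (contDiff_gainFlow c₀ a m).contDiffOn.exists_lipschitzOnWith (by decide)
    (convex_closedBall (0 : ℝ) R) (isCompact_closedBall (0 : ℝ) R)
  exact (hK'.comp hθ (mapsTo_iff_image_subset.2 hR)).absolutelyContinuousOnInterval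

/-- The internal clock of a solution of the modified Smoluchowski equation. -/
noncomputable def armClock (c : ℝ → ℕ → ℕ → ℝ) (t : ℝ) : ℝ :=
  ∫ s in (0 : ℝ)..t, Real.exp (-(2 * s)) * (armSum (c s))⁻¹

namespace IsModifiedSmoluchowskiSolution

variable {c : ℝ → ℕ → ℕ → ℝ} {c₀ : ℕ → ℕ → ℝ}

lemma exists_armSum_bound (hc : IsModifiedSmoluchowskiSolution c c₀) {t : ℝ} (ht : 0 ≤ t) :
    ∃ κ > 0, ∀ s ∈ Icc 0 t, κ ≤ armSum (c s) :=
  ⟨_, (hc.2.2.2 t ht).1, fun s hs => csInf_le ⟨0, by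
    rintro _ ⟨r, hr, rfl⟩
    exact tsum_nonneg fun p => mul_nonneg (Nat.cast_nonneg _) (hc.1 r hr.1 _ _)⟩ ⟨s, hs, rfl⟩⟩

lemma armSum_pos (hc : IsModifiedSmoluchowskiSolution c c₀) {t : ℝ} (ht : 0 ≤ t) :
    0 < armSum (c t) := by
  obtain ⟨κ, hκ, h⟩ := hc.exists_armSum_bound ht
  exact hκ.trans_le (h t ⟨ht, le_rfl⟩)

lemma summable_arm (hc : IsModifiedSmoluchowskiSolution c c₀) {t : ℝ} (ht : 0 ≤ t) :
    Summable fun p : ℕ × ℕ => (p.1 : ℝ) * c t p.1 p.2 := by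
  by_contra h
  exact (hc.armSum_pos ht).ne' (tsum_eq_zero_of_not_summable h)

lemma intervalIntegrable_inv_armSum (hc : IsModifiedSmoluchowskiSolution c c₀) {t : ℝ}
    (ht : 0 ≤ t) : IntervalIntegrable (fun s => (armSum (c s))⁻¹) volume 0 t := by
  obtain ⟨κ, hκ, h⟩ := hc.exists_armSum_bound ht
  have hi := (hc.2.2.2 t ht).2.2.1
  rw [intervalIntegrable_iff_integrableOn_Ioc_of_le ht] at hi ⊢
  have hm : AEStronglyMeasurable (fun s => (armSum (c s))⁻¹) (volume.restrict (Ioc 0 t)) := by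
    have h1 : AEMeasurable (fun s => (Real.sqrt (armSum (c s) ^ 2))⁻¹)
      (volume.restrict (Ioc 0 t)) := hi.aestronglyMeasurable.aemeasurable.sqrt.inv
    refine (h1.congr ?_).aestronglyMeasurable
    filter_upwards [ae_restrict_mem measurableSet_Ioc] with s hs
    rw [Real.sqrt_sq (hc.armSum_pos hs.1.le).le]
  refine Integrable.of_bound hm κ⁻¹ ?_
  filter_upwards [ae_restrict_mem measurableSet_Ioc] with s hs
  rw [norm_inv, Real.norm_of_nonneg (hc.armSum_pos hs.1.le).le]
  exact inv_anti₀ hκ (h s ⟨hs.1.le, hs.2⟩)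

lemma intervalIntegrable_clockRate (hc : IsModifiedSmoluchowskiSolution c c₀) {s t : ℝ}
    (hs : 0 ≤ s) (ht : 0 ≤ t) :
    IntervalIntegrable (fun s => Real.exp (-(2 * s)) * (armSum (c s))⁻¹) volume s t := by
  have h : ∀ r : ℝ, 0 ≤ r →
      IntervalIntegrable (fun s => Real.exp (-(2 * s)) * (armSum (c s))⁻¹) volume 0 r :=
    fun r hr => (hc.intervalIntegrable_inv_armSum hr).continuousOn_mul (by fun_prop)
  exact (h s hs).symm.trans (h t ht)

lemma armClock_sub (hc : IsModifiedSmoluchowskiSolution c c₀) {s t : ℝ} (hs : 0 ≤ s)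
    (ht : 0 ≤ t) : armClock c t - armClock c s =
      ∫ r in s..t, Real.exp (-(2 * r)) * (armSum (c r))⁻¹ :=
  intervalIntegral.integral_interval_sub_left (hc.intervalIntegrable_clockRate le_rfl ht)
    (hc.intervalIntegrable_clockRate le_rfl hs)

lemma exists_lipschitzOnWith_armClock (hc : IsModifiedSmoluchowskiSolution c c₀) {t : ℝ}
    (ht : 0 ≤ t) : ∃ K, LipschitzOnWith K (armClock c) (uIcc 0 t) := by
  obtain ⟨κ, hκ, h⟩ := hc.exists_armSum_bound ht
  refine ⟨⟨κ⁻¹, (inv_pos.2 hκ).le⟩, LipschitzOnWith.of_dist_le_mul fun x hx y hy => ?_⟩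
  rw [uIcc_of_le ht] at hx hy
  rw [Real.dist_eq, hc.armClock_sub hy.1 hx.1, Real.dist_eq, ← Real.norm_eq_abs]
  refine intervalIntegral.norm_integral_le_of_norm_le_const fun r hr => ?_
  have hr' : r ∈ Icc 0 t := (uIcc_subset_Icc hy hx) (uIoc_subset_uIcc hr)
  have hA := hc.armSum_pos hr'.1
  rw [norm_mul, norm_inv, Real.norm_of_nonneg hA.le, Real.norm_of_nonneg (Real.exp_pos _).le]
  have h1 : Real.exp (-(2 * r)) ≤ 1 := Real.exp_le_one_iff.2 (by linarith [hr'.1])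
  have h2 := inv_anti₀ hκ (h r hr')
  exact (mul_le_mul h1 h2 (inv_pos.2 hA).le zero_le_one).trans_eq (one_mul _)

lemma continuousOn_armClock (hc : IsModifiedSmoluchowskiSolution c c₀) {t : ℝ} (ht : 0 ≤ t) :
    ContinuousOn (armClock c) (Icc 0 t) := by
  obtain ⟨K, hK⟩ := hc.exists_lipschitzOnWith_armClock ht
  rw [uIcc_of_le ht] at hK
  exact hK.continuousOn

lemma armClock_nonneg (hc : IsModifiedSmoluchowskiSolution c c₀) {t : ℝ} (ht : 0 ≤ t) :
    0 ≤ armClock c t :=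
  intervalIntegral.integral_nonneg ht fun _ hs =>
    mul_nonneg (Real.exp_pos _).le (inv_pos.2 (hc.armSum_pos hs.1)).le

/-- A solution is determined by its internal clock. -/
lemma eq_exp_mul_gainFlow (hc : IsModifiedSmoluchowskiSolution c c₀) (h₀ : ∀ a, c₀ a 0 = 0)
    {t : ℝ} (ht : 0 ≤ t) (a m : ℕ) :
    c t a m = Real.exp (-(a * t)) * gainFlow c₀ (armClock c t) a m := by
  induction m using Nat.strong_induction_on generalizing a t with
  | _ m ih =>
    rcases Nat.eq_zero_or_pos m with rfl | hm
    · rw [hc.2.1 t ht, gainFlow_mass_zero h₀, mul_zero]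
    set g : ℝ → ℝ := fun s => (armSum (c s))⁻¹ * coagGain (c s) a m - a * c s a m with hg
    have hcont : ∀ a' m', ContinuousOn (fun s => c s a' m') (Icc 0 t) := fun a' m' =>
      (hc.2.2.1 a' m').mono Icc_subset_Ici_self
    have hgi : IntervalIntegrable g volume 0 t := by
      refine ((hc.intervalIntegrable_inv_armSum ht).mul_continuousOn ?_).sub
        (ContinuousOn.intervalIntegrable ?_)
      · rw [uIcc_of_le ht]
        exact continuous_coagGain_of_lt (fun m' _ a' => hcont a' m') a
      · rw [uIcc_of_le ht]
        exact continuousOn_const.mul (hcont a m)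
    have hcg : ∀ s ∈ Icc 0 t, c s a m = c₀ a m + ∫ r in (0 : ℝ)..s, g r := by
      intro s hs
      rw [← sub_eq_iff_eq_add', (hc.2.2.2 s hs.1).2.2.2 a m hm]
      refine intervalIntegral.integral_congr fun r hr => ?_
      rw [uIcc_of_le hs.1] at hr
      have hA := (hc.armSum_pos hr.1).ne'
      simp only [hg, coagLoss_eq]
      field_simp
    obtain ⟨K, hK⟩ := hc.exists_lipschitzOnWith_armClock ht
    have hexp : AbsolutelyContinuousOnInterval (fun s : ℝ => Real.exp (a * s)) 0 t :=
      ContDiffOn.absolutelyContinuousOnInterval (by fun_prop)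
    have hconst : AbsolutelyContinuousOnInterval (fun _ : ℝ => c₀ a m) 0 t :=
      contDiffOn_const.absolutelyContinuousOnInterval
    have hac : AbsolutelyContinuousOnInterval (fun s => Real.exp (a * s) *
        (c₀ a m + ∫ r in (0 : ℝ)..s, g r) - gainFlow c₀ (armClock c s) a m) 0 t :=
      (hexp.fun_mul (hconst.fun_add
        (hgi.absolutelyContinuousOnInterval_intervalIntegral left_mem_uIcc))).fun_sub
        (absolutelyContinuous_gainFlow_comp c₀ a m hK)
    obtain ⟨C, hC⟩ := hac.const_of_ae_hasDerivAt_zero (by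
      filter_upwards [hgi.ae_hasDerivAt_integral,
        (hc.intervalIntegrable_clockRate le_rfl ht).ae_hasDerivAt_integral] with s h1 h2 hs
      have h1 := h1 hs 0 left_mem_uIcc
      have h2 : HasDerivAt (armClock c) _ s := h2 hs 0 left_mem_uIcc
      have he : HasDerivAt (fun s : ℝ => Real.exp (a * s)) (Real.exp (a * s) * a) s := by
        simpa using ((hasDerivAt_id s).const_mul (a : ℝ)).exp
      have hd := (he.mul (h1.const_add (c₀ a m))).sub
        ((hasDerivAt_gainFlow c₀ a m (armClock c s)).comp s h2)
      convert! hd using 1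
      rw [uIcc_of_le ht] at hs
      rw [← hcg s hs]
      have hgain : coagGain (c s) a m = Real.exp (-(a * s)) * Real.exp (-(2 * s)) *
          coagGain (gainFlow c₀ (armClock c s)) a m := by
        rw [← coagGain_exp_mul]
        exact coagGain_congr_of_lt (fun m' hm' a' => ih m' hm' hs.1 a') a
      have hee : Real.exp (a * s) * Real.exp (-(a * s)) = 1 := by
        rw [← Real.exp_add, add_neg_cancel, Real.exp_zero]
      simp only [hg, hgain]
      linear_combination (-(armSum (c s))⁻¹ * Real.exp (-(2 * s)) *
        coagGain (gainFlow c₀ (armClock c s)) a m) * hee)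
    have hC0 := hC 0 left_mem_uIcc
    have hCt := hC t right_mem_uIcc
    rw [← hcg t ⟨ht, le_rfl⟩] at hCt
    simp only [armClock, mul_zero, Real.exp_zero, intervalIntegral.integral_same, add_zero,
      one_mul, gainFlow_zero, sub_self] at hC0
    rw [← hC0, sub_eq_zero] at hCt
    rw [← hCt, ← mul_assoc, ← Real.exp_add, neg_add_cancel, Real.exp_zero, one_mul]

lemma armSum_le_of_armClock_le {c' : ℝ → ℕ → ℕ → ℝ} (hc : IsModifiedSmoluchowskiSolution c c₀)
    (hc' : IsModifiedSmoluchowskiSolution c' c₀) (h₀ : ∀ a m, 0 ≤ c₀ a m)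
    (h₀' : ∀ a, c₀ a 0 = 0) {t : ℝ} (ht : 0 ≤ t) (h : armClock c t ≤ armClock c' t) :
    armSum (c t) ≤ armSum (c' t) := by
  refine (hc.summable_arm ht).tsum_le_tsum (fun p => ?_) (hc'.summable_arm ht)
  rw [hc.eq_exp_mul_gainFlow h₀' ht, hc'.eq_exp_mul_gainFlow h₀' ht]
  have := gainFlow_mono h₀ (hc.armClock_nonneg ht) h p.1 p.2
  gcongr

lemma armClock_le {c' : ℝ → ℕ → ℕ → ℝ} (hc : IsModifiedSmoluchowskiSolution c c₀)
    (hc' : IsModifiedSmoluchowskiSolution c' c₀) (h₀ : ∀ a m, 0 ≤ c₀ a m)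
    (h₀' : ∀ a, c₀ a 0 = 0) {t : ℝ} (ht : 0 ≤ t) : armClock c t ≤ armClock c' t := by
  by_contra! hlt
  obtain ⟨t₀, ⟨ht₀, hle⟩, hmax⟩ := IsCompact.exists_isGreatest
    (s := {s ∈ Icc 0 t | armClock c s ≤ armClock c' s})
    (isCompact_Icc.of_isClosed_subset (isClosed_Icc.isClosed_le (hc.continuousOn_armClock ht)
      (hc'.continuousOn_armClock ht)) (sep_subset _ _))
    ⟨0, ⟨le_rfl, ht⟩, by simp [armClock]⟩
  have hrate : ∫ r in t₀..t, Real.exp (-(2 * r)) * (armSum (c r))⁻¹ ≤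
      ∫ r in t₀..t, Real.exp (-(2 * r)) * (armSum (c' r))⁻¹ := by
    refine intervalIntegral.integral_mono_on_of_le_Ioo ht₀.2
      (hc.intervalIntegrable_clockRate ht₀.1 ht) (hc'.intervalIntegrable_clockRate ht₀.1 ht)
      fun r hr => ?_
    have hr0 : 0 ≤ r := ht₀.1.trans hr.1.le
    have hcr : armClock c' r ≤ armClock c r := by
      by_contra! hcon
      exact hr.1.not_ge (hmax ⟨⟨hr0, hr.2.le⟩, hcon.le⟩)
    exact mul_le_mul_of_nonneg_left (inv_anti₀ (hc'.armSum_pos hr0)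
      (hc'.armSum_le_of_armClock_le hc h₀ h₀' hr0 hcr)) (Real.exp_pos _).le
  rw [← hc.armClock_sub ht₀.1 ht, ← hc'.armClock_sub ht₀.1 ht] at hrate
  linarith

lemma unique {c' : ℝ → ℕ → ℕ → ℝ} (hc : IsModifiedSmoluchowskiSolution c c₀)
    (hc' : IsModifiedSmoluchowskiSolution c' c₀) (h₀ : ∀ a m, 0 ≤ c₀ a m)
    (h₀' : ∀ a, c₀ a 0 = 0) {t : ℝ} (ht : 0 ≤ t) (a m : ℕ) : c t a m = c' t a m := by
  rw [hc.eq_exp_mul_gainFlow h₀' ht, hc'.eq_exp_mul_gainFlow h₀' ht,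
    (hc.armClock_le hc' h₀ h₀' ht).antisymm (hc'.armClock_le hc h₀ h₀' ht)]

end IsModifiedSmoluchowskiSolution

/-- The arm generating function of a concentration profile. -/
noncomputable def armGen (b : ℕ → ℕ → ℝ) (z : ℝ) : ℝ := ∑' p : ℕ × ℕ, armTerm b z p

section armGen

variable {c₀ : ℕ → ℕ → ℝ}

lemma armTerm_le (h₀ : ∀ a m, 0 ≤ c₀ a m) {z : ℝ} (hz : z ∈ Icc (0 : ℝ) 1) (p : ℕ × ℕ) :
    armTerm c₀ z p ≤ p.1 * c₀ p.1 p.2 :=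
  mul_le_of_le_one_right (mul_nonneg (Nat.cast_nonneg _) (h₀ _ _)) (pow_le_one₀ hz.1 hz.2)

lemma hasSum_armGen (h₀ : ∀ a m, 0 ≤ c₀ a m)
    (hs : Summable fun p : ℕ × ℕ => (p.1 : ℝ) * c₀ p.1 p.2) {z : ℝ} (hz : z ∈ Icc (0 : ℝ) 1) :
    HasSum (armTerm c₀ z) (armGen c₀ z) :=
  (Summable.of_nonneg_of_le (armTerm_nonneg h₀ hz.1) (armTerm_le h₀ hz) hs).hasSum

lemma tendsto_armPoly (h₀ : ∀ a m, 0 ≤ c₀ a m)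
    (hs : Summable fun p : ℕ × ℕ => (p.1 : ℝ) * c₀ p.1 p.2) {z : ℝ} (hz : z ∈ Icc (0 : ℝ) 1) :
    Filter.Tendsto (fun N => armPoly c₀ N z) Filter.atTop (nhds (armGen c₀ z)) :=
  (hasSum_armGen h₀ hs hz).comp tendsto_clusterTriangle

lemma armPoly_le_armGen (h₀ : ∀ a m, 0 ≤ c₀ a m)
    (hs : Summable fun p : ℕ × ℕ => (p.1 : ℝ) * c₀ p.1 p.2) {z : ℝ} (hz : z ∈ Icc (0 : ℝ) 1)
    (N : ℕ) : armPoly c₀ N z ≤ armGen c₀ z :=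
  sum_le_hasSum _ (fun p _ => armTerm_nonneg h₀ hz.1 p) (hasSum_armGen h₀ hs hz)

lemma armGen_mono (h₀ : ∀ a m, 0 ≤ c₀ a m)
    (hs : Summable fun p : ℕ × ℕ => (p.1 : ℝ) * c₀ p.1 p.2) {z z' : ℝ} (hz : 0 ≤ z)
    (hzz : z ≤ z') (hz' : z' ≤ 1) : armGen c₀ z ≤ armGen c₀ z' :=
  hasSum_le (armTerm_mono h₀ hz hzz) (hasSum_armGen h₀ hs ⟨hz, hzz.trans hz'⟩)
    (hasSum_armGen h₀ hs ⟨hz.trans hzz, hz'⟩)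

lemma continuousOn_armGen (h₀ : ∀ a m, 0 ≤ c₀ a m)
    (hs : Summable fun p : ℕ × ℕ => (p.1 : ℝ) * c₀ p.1 p.2) :
    ContinuousOn (armGen c₀) (Icc 0 1) := by
  refine continuousOn_tsum (f := fun p z => armTerm c₀ z p) (fun p => ?_) hs fun p z hz => ?_
  · unfold armTerm
    fun_prop
  · rw [Real.norm_of_nonneg (armTerm_nonneg h₀ hz.1 p)]
    exact armTerm_le h₀ hz p

lemma armGen_pos (h₀ : ∀ a m, 0 ≤ c₀ a m)
    (hs : Summable fun p : ℕ × ℕ => (p.1 : ℝ) * c₀ p.1 p.2) (harm : 0 < armSum c₀) {z : ℝ}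
    (hz : z ∈ Ioc (0 : ℝ) 1) : 0 < armGen c₀ z := by
  obtain ⟨p, hp⟩ : ∃ p : ℕ × ℕ, (p.1 : ℝ) * c₀ p.1 p.2 ≠ 0 := by
    by_contra! h
    simp [armSum, h] at harm
  have hp' : 0 < (p.1 : ℝ) * c₀ p.1 p.2 :=
    lt_of_le_of_ne (mul_nonneg (Nat.cast_nonneg _) (h₀ _ _)) hp.symm
  exact (hasSum_armGen h₀ hs ⟨hz.1.le, hz.2⟩).summable.tsum_pos
    (armTerm_nonneg h₀ hz.1.le) p (mul_pos hp' (pow_pos hz.1 _))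

/-- The characteristic reaching `s` last starts from some `l`, and the generating function of the
gain flow at `s` keeps at that time its initial value at `l`. -/
lemma exists_last_characteristic (h₀ : ∀ a m, 0 ≤ c₀ a m) (h₀' : ∀ a, c₀ a 0 = 0)
    (hs : Summable fun p : ℕ × ℕ => (p.1 : ℝ) * c₀ p.1 p.2) (harm : 0 < armSum c₀) {s : ℝ}
    (hs01 : s ∈ Ioc (0 : ℝ) 1) : ∃ l ∈ Icc s 1,
      (∀ z ∈ Icc s 1, (z - s) / armGen c₀ z ≤ (l - s) / armGen c₀ l) ∧
      HasSum (armTerm (gainFlow c₀ ((l - s) / armGen c₀ l)) s) (armGen c₀ l) := by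
  have hIcc : Icc s 1 ⊆ Icc (0 : ℝ) 1 := Icc_subset_Icc_left hs01.1.le
  have hpos : ∀ z ∈ Icc s 1, 0 < armGen c₀ z := fun z hz =>
    armGen_pos h₀ hs harm ⟨hs01.1.trans_le hz.1, hz.2⟩
  have hcont : ContinuousOn (fun z => (z - s) / armGen c₀ z) (Icc s 1) :=
    (by fun_prop : ContinuousOn (fun z : ℝ => z - s) (Icc s 1)).div
      ((continuousOn_armGen h₀ hs).mono hIcc) fun z hz => (hpos z hz).ne'
  obtain ⟨l₀, hl₀, hmax₀⟩ := isCompact_Icc.exists_isMaxOn ⟨s, left_mem_Icc.2 hs01.2⟩ hcont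
  obtain ⟨l, ⟨hl, hll⟩, hleast⟩ := IsCompact.exists_isLeast
    (s := {z ∈ Icc s 1 | (l₀ - s) / armGen c₀ l₀ ≤ (z - s) / armGen c₀ z})
    (isCompact_Icc.of_isClosed_subset
      (isClosed_Icc.isClosed_le continuousOn_const hcont) (sep_subset _ _))
    ⟨l₀, hl₀, le_rfl⟩
  have hmax : ∀ z ∈ Icc s 1, (z - s) / armGen c₀ z ≤ (l - s) / armGen c₀ l := fun z hz =>
    (hmax₀ hz).trans hll
  refine ⟨l, hl, hmax, ?_⟩
  set T : ℝ := (l - s) / armGen c₀ l with hTdef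
  have hV := hpos l hl
  have hT : 0 ≤ T := div_nonneg (sub_nonneg.2 hl.1) hV.le
  have hls : l - T * armGen c₀ l = s := by
    rw [hTdef, div_mul_cancel₀ _ hV.ne']
    ring
  have hbelow : ∀ z ∈ Ioo 0 l, z - T * armGen c₀ z < s := by
    intro z hz
    have hz1 : z ≤ 1 := hz.2.le.trans hl.2
    have hVz := armGen_pos h₀ hs harm ⟨hz.1, hz1⟩
    rcases lt_or_ge z s with h | h
    · linarith [mul_nonneg hT hVz.le]
    · have hlt : (z - s) / armGen c₀ z < T := by
        by_contra! hge
        exact hz.2.not_ge (hleast ⟨⟨h, hz1⟩, hll.trans hge⟩)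
      rw [div_lt_iff₀ hVz] at hlt
      linarith
  have hflow : ∀ a m, 0 ≤ gainFlow c₀ T a m := gainFlow_nonneg h₀ hT
  have hupper : ∀ N, armPoly (gainFlow c₀ T) N s ≤ armGen c₀ l := fun N => by
    have := armPoly_gainFlow_le h₀ hV.le (armPoly_le_armGen h₀ hs (hIcc hl) N) hT
      (hls.symm ▸ hs01.1.le)
    rwa [hls] at this
  have hsum : Summable (armTerm (gainFlow c₀ T) s) := by
    refine summable_of_sum_le (c := armGen c₀ l) (armTerm_nonneg hflow hs01.1.le) fun u => ?_
    obtain ⟨N, hN⟩ := exists_subset_clusterTriangle u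
    exact (Finset.sum_le_sum_of_subset_of_nonneg hN fun p _ _ =>
      armTerm_nonneg hflow hs01.1.le p).trans (hupper N)
  have hlim : Filter.Tendsto (fun N => armPoly (gainFlow c₀ T) N s) Filter.atTop
      (nhds (∑' p, armTerm (gainFlow c₀ T) s p)) := hsum.hasSum.comp tendsto_clusterTriangle
  have hl0 : 0 < l := hs01.1.trans_le hl.1
  have hVcont : Filter.Tendsto (armGen c₀) (nhdsWithin l (Ioo 0 l)) (nhds (armGen c₀ l)) :=
    (continuousOn_armGen h₀ hs l (hIcc hl)).mono
      (Ioo_subset_Icc_self.trans (Icc_subset_Icc_right hl.2))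
  have hne : (nhdsWithin l (Ioo 0 l)).NeBot := by
    rw [nhdsWithin_Ioo_eq_nhdsLT hl0]
    infer_instance
  have hlower : armGen c₀ l ≤ ∑' p, armTerm (gainFlow c₀ T) s p := by
    refine le_of_tendsto hVcont ?_
    have hpos' : ∀ᶠ z in nhdsWithin l (Ioo 0 l), 0 < z - T * armGen c₀ z := by
      have h1 : Filter.Tendsto (fun z => z - T * armGen c₀ z) (nhdsWithin l (Ioo 0 l)) (nhds s) :=
        hls ▸ (tendsto_nhdsWithin_of_tendsto_nhds Filter.tendsto_id).sub (hVcont.const_mul T)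
      exact h1.eventually_const_lt hs01.1
    filter_upwards [hpos', self_mem_nhdsWithin] with z hz0 hz
    have hz01 : z ∈ Icc (0 : ℝ) 1 := ⟨hz.1.le, hz.2.le.trans hl.2⟩
    have hlt := hbelow z hz
    refine le_of_tendsto_of_tendsto' (tendsto_armPoly_gainFlow h₀ h₀'
      (armGen_pos h₀ hs harm ⟨hz.1, hz01.2⟩).le (tendsto_armPoly h₀ hs hz01)
      (armGen_mono h₀ hs hz01.1 hz.2.le hl.2) (armPoly_le_armGen h₀ hs (hIcc hl)) hT hz0.le
      (hls.symm ▸ hlt)) hlim fun N => armPoly_mono hflow hz0.le hlt.le N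
  exact le_antisymm (le_of_tendsto' hlim hupper) hlower ▸ hsum.hasSum

/-- The internal clock `θ` of the solution to be constructed, its generating function `w`, and the
convexity of the clock as a function of `exp (-t)`. -/
lemma exists_clock (h₀ : ∀ a m, 0 ≤ c₀ a m) (h₀' : ∀ a, c₀ a 0 = 0)
    (hs : Summable fun p : ℕ × ℕ => (p.1 : ℝ) * c₀ p.1 p.2) (harm : 0 < armSum c₀) :
    ∃ θ w : ℝ → ℝ, θ 0 = 0 ∧ ∀ t, 0 ≤ t → 0 ≤ θ t ∧
      HasSum (armTerm (gainFlow c₀ (θ t)) (Real.exp (-t))) (w t) ∧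
      armGen c₀ (Real.exp (-t)) ≤ w t ∧ w t ≤ armGen c₀ 1 ∧
      ∀ r, 0 ≤ r → θ t - (Real.exp (-r) - Real.exp (-t)) / w t ≤ θ r := by
  have hmem : ∀ t : ℝ, 0 ≤ t → Real.exp (-t) ∈ Ioc (0 : ℝ) 1 := fun t ht =>
    ⟨Real.exp_pos _, Real.exp_le_one_iff.2 (by linarith)⟩
  have hex : ∀ t : ℝ, 0 ≤ t → _ := fun t ht =>
    exists_last_characteristic h₀ h₀' hs harm (hmem t ht)
  choose! L hL hmax hsum using hex
  have hθ : ∀ t, 0 ≤ t → 0 ≤ (L t - Real.exp (-t)) / armGen c₀ (L t) := fun t ht =>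
    div_nonneg (sub_nonneg.2 (hL t ht).1)
      (armGen_pos h₀ hs harm ⟨(Real.exp_pos _).trans_le (hL t ht).1, (hL t ht).2⟩).le
  refine ⟨fun t => (L t - Real.exp (-t)) / armGen c₀ (L t), fun t => armGen c₀ (L t), ?_,
    fun t ht => ⟨hθ t ht, hsum t ht, ?_, ?_, fun r hr => ?_⟩⟩
  · have h := hL 0 le_rfl
    simp only [neg_zero, Real.exp_zero] at h ⊢
    rw [le_antisymm h.2 h.1, sub_self, zero_div]
  · exact armGen_mono h₀ hs (Real.exp_pos _).le (hL t ht).1 (hL t ht).2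
  · exact armGen_mono h₀ hs ((Real.exp_pos _).le.trans (hL t ht).1) (hL t ht).2 le_rfl
  · rw [← sub_div, sub_sub_sub_cancel_right]
    rcases le_total (Real.exp (-r)) (L t) with h | h
    · convert hmax r hr (L t) ⟨h, (hL t ht).2⟩
    · have hV := armGen_pos h₀ hs harm ⟨(Real.exp_pos _).trans_le (hL t ht).1, (hL t ht).2⟩
      refine le_trans (div_nonpos_of_nonpos_of_nonneg ?_ hV.le) (hθ r hr)
      linarith

end armGen

lemma exp_neg_sub_exp_neg_le {x y : ℝ} (hy : 0 ≤ y) :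
    Real.exp (-y) - Real.exp (-x) ≤ |x - y| := by
  have h1 : Real.exp (-x) = Real.exp (-y) * Real.exp (y - x) := by
    rw [← Real.exp_add]
    ring_nf
  have h2 := mul_le_mul_of_nonneg_left (Real.add_one_le_exp (y - x)) (Real.exp_pos (-y)).le
  have h3 : Real.exp (-y) ≤ 1 := Real.exp_le_one_iff.2 (by linarith)
  calc Real.exp (-y) - Real.exp (-x) ≤ Real.exp (-y) * (x - y) := by
        rw [h1]
        linarith
    _ ≤ Real.exp (-y) * |x - y| := mul_le_mul_of_nonneg_left (le_abs_self _) (Real.exp_pos _).le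
    _ ≤ |x - y| := mul_le_of_le_one_left (abs_nonneg _) h3

lemma hasSum_arm_exp_mul {b : ℕ → ℕ → ℝ} {t w : ℝ} (h : HasSum (armTerm b (Real.exp (-t))) w) :
    HasSum (fun p : ℕ × ℕ => (p.1 : ℝ) * (Real.exp (-(p.1 * t)) * b p.1 p.2))
      (Real.exp (-t) * w) := by
  convert! h.mul_left (Real.exp (-t)) using 2 with ⟨a, m⟩
  rcases a with _ | a
  · simp [armTerm]
  · have : Real.exp (-((a + 1 : ℕ) * t)) = Real.exp (-t) * Real.exp (-t) ^ a := by
      rw [← Real.exp_nat_mul, ← Real.exp_add]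
      push_cast
      ring_nf
    simp only [armTerm, this, Nat.add_sub_cancel]
    ring

theorem exists_isModifiedSmoluchowskiSolution {c₀ : ℕ → ℕ → ℝ} (h₀ : ∀ a m, 0 ≤ c₀ a m)
    (h₀' : ∀ a, c₀ a 0 = 0) (hs : Summable fun p : ℕ × ℕ => (p.1 : ℝ) * c₀ p.1 p.2)
    (harm : 0 < armSum c₀) : ∃ c, IsModifiedSmoluchowskiSolution c c₀ := by
  obtain ⟨θ, w, hθ0, h⟩ := exists_clock h₀ h₀' hs harm
  have hexp1 : ∀ t : ℝ, 0 ≤ t → Real.exp (-t) ≤ 1 := fun t ht =>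
    Real.exp_le_one_iff.2 (by linarith)
  have hκ : ∀ T : ℝ, 0 ≤ T → 0 < armGen c₀ (Real.exp (-T)) := fun T hT =>
    armGen_pos h₀ hs harm ⟨Real.exp_pos _, hexp1 T hT⟩
  have hwκ : ∀ T, ∀ t ∈ Icc 0 T, armGen c₀ (Real.exp (-T)) ≤ w t := fun T t ht =>
    (armGen_mono h₀ hs (Real.exp_pos _).le (Real.exp_le_exp.2 (neg_le_neg ht.2))
      (hexp1 t ht.1)).trans (h t ht.1).2.2.1
  have hw : ∀ t, 0 ≤ t → 0 < w t := fun t ht => (hκ t ht).trans_le (hwκ t t ⟨ht, le_rfl⟩)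
  have hlip : ∀ T, 0 ≤ T → ∃ K, LipschitzOnWith K θ (uIcc 0 T) := fun T hT => by
    refine ⟨⟨(armGen c₀ (Real.exp (-T)))⁻¹, (inv_pos.2 (hκ T hT)).le⟩,
      LipschitzOnWith.of_le_add_mul _ fun x hx y hy => ?_⟩
    rw [uIcc_of_le hT] at hx hy
    have h1 := (h x hx.1).2.2.2.2 y hy.1
    have h2 : (Real.exp (-y) - Real.exp (-x)) / w x ≤
        (armGen c₀ (Real.exp (-T)))⁻¹ * |x - y| := by
      rw [div_eq_inv_mul]
      exact (mul_le_mul_of_nonneg_left (exp_neg_sub_exp_neg_le hy.1)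
        (inv_pos.2 (hw x hx.1)).le).trans (mul_le_mul_of_nonneg_right
          (inv_anti₀ (hκ T hT) (hwκ T x hx)) (abs_nonneg _))
    rw [Real.dist_eq]
    change θ x ≤ θ y + (armGen c₀ (Real.exp (-T)))⁻¹ * |x - y|
    linarith
  have hanti : AntitoneOn w (Ici 0) := by
    intro x hx y hy hxy
    rcases hxy.eq_or_lt with rfl | hlt
    · exact le_rfl
    have h1 := (h x hx).2.2.2.2 y hy
    have h2 := (h y hy).2.2.2.2 x hx
    have hd : 0 < Real.exp (-x) - Real.exp (-y) :=
      sub_pos.2 (Real.exp_lt_exp.2 (neg_lt_neg hlt))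
    have h3 : (Real.exp (-x) - Real.exp (-y)) / w x ≤ (Real.exp (-x) - Real.exp (-y)) / w y := by
      rw [← neg_sub (Real.exp (-x)), neg_div] at h1
      linarith
    exact (div_le_div_iff_of_pos_left hd (hw x hx) (hw y hy)).1 h3
  have hderiv : ∀ t, 0 < t → DifferentiableAt ℝ θ t →
      HasDerivAt θ (Real.exp (-t) / w t) t := by
    intro t ht hd
    have he : HasDerivAt (fun r : ℝ => Real.exp (-r)) (-Real.exp (-t)) t := by
      simpa using (hasDerivAt_neg t).exp
    have hmin : IsLocalMin (fun r => θ r + Real.exp (-r) / w t) t := by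
      filter_upwards [lt_mem_nhds ht] with r hr
      have := (h t ht.le).2.2.2.2 r hr.le
      rw [sub_div] at this
      linarith
    have h0 := hmin.hasDerivAt_eq_zero (hd.hasDerivAt.add (he.div_const (w t)))
    rw [neg_div, ← sub_eq_add_neg, sub_eq_zero] at h0
    exact h0 ▸ hd.hasDerivAt
  set c : ℝ → ℕ → ℕ → ℝ := fun t a m => Real.exp (-(a * t)) * gainFlow c₀ (θ t) a m with hc
  have harmSum : ∀ t, 0 ≤ t → armSum (c t) = Real.exp (-t) * w t := fun t ht =>
    (hasSum_arm_exp_mul (h t ht).2.1).tsum_eq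
  have hc0 : ∀ t ∈ Ici (0 : ℝ), ∀ a m, 0 ≤ c t a m := fun t ht a m =>
    mul_nonneg (Real.exp_pos _).le (gainFlow_nonneg h₀ (h t ht).1 a m)
  have hAanti : AntitoneOn (fun t => armSum (c t)) (Ici 0) := fun x hx y hy hxy => by
    simp only [harmSum x hx, harmSum y hy]
    exact mul_le_mul (Real.exp_le_exp.2 (neg_le_neg hxy)) (hanti hx hy hxy) (hw y hy).le
      (Real.exp_pos _).le
  have hA : ∀ t, 0 ≤ t → 0 < armSum (c t) := fun t ht => by
    rw [harmSum t ht]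
    exact mul_pos (Real.exp_pos _) (hw t ht)
  have hac : ∀ T, 0 ≤ T → ∀ a m, AbsolutelyContinuousOnInterval (fun t => c t a m) 0 T := by
    intro T hT a m
    obtain ⟨K, hK⟩ := hlip T hT
    have hE : AbsolutelyContinuousOnInterval (fun t : ℝ => Real.exp (-(a * t))) 0 T :=
      ContDiffOn.absolutelyContinuousOnInterval (by fun_prop)
    exact hE.fun_mul (absolutelyContinuous_gainFlow_comp c₀ a m hK)
  refine ⟨c, hc0, fun t _ a => by simp [hc, gainFlow_mass_zero h₀'], fun a m t ht => ?_,
    fun T hT => ⟨?_, ?_, ?_, fun a m _ => ?_⟩⟩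
  · have ht1 : t < t + 1 := lt_add_one t
    have hcont := (hac (t + 1) (le_trans ht ht1.le) a m).continuousOn
    rw [uIcc_of_le (le_trans ht ht1.le)] at hcont
    refine (hcont t ⟨ht, ht1.le⟩).mono_of_mem_nhdsWithin ?_
    rw [← Ici_inter_Iic]
    exact Filter.inter_mem self_mem_nhdsWithin (mem_nhdsWithin_of_mem_nhds (Iic_mem_nhds ht1))
  · refine (hA T hT).trans_le (le_csInf ⟨_, mem_image_of_mem _ (left_mem_Icc.2 hT)⟩ ?_)
    rintro _ ⟨r, hr, rfl⟩
    exact hAanti hr.1 hT hr.2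
  · refine ⟨armSum (c 0), ?_⟩
    rintro _ ⟨r, hr, rfl⟩
    exact hAanti self_mem_Ici hr.1 hr.1
  · refine AntitoneOn.intervalIntegrable fun x hx y hy hxy => ?_
    rw [uIcc_of_le hT] at hx hy
    exact pow_le_pow_left₀ (hA y hy.1).le (hAanti hx.1 hy.1 hxy) 2
  · have hFTC := (hac T hT a m).integral_deriv_eq_sub
    have hinit : c 0 a m = c₀ a m := by simp [hc, hθ0, gainFlow_zero]
    rw [← hinit, ← hFTC]
    obtain ⟨K, hK⟩ := hlip T hT
    refine intervalIntegral.integral_congr_ae ?_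
    filter_upwards [hK.absolutelyContinuousOnInterval.ae_differentiableAt] with t hdiff ht
    have hd := hdiff (uIoc_subset_uIcc ht)
    rw [uIoc_of_le hT] at ht
    have hE : HasDerivAt (fun r : ℝ => Real.exp (-(a * r))) (Real.exp (-(a * t)) * -a) t := by
      simpa using ((hasDerivAt_id t).const_mul (a : ℝ)).neg.exp
    have hD := hE.mul ((hasDerivAt_gainFlow c₀ a m (θ t)).comp t (hderiv t ht.1 hd))
    have hgain : coagGain (c t) a m = Real.exp (-(a * t)) * Real.exp (-(2 * t)) *
        coagGain (gainFlow c₀ (θ t)) a m := coagGain_exp_mul _ _ _ _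
    have he2 : Real.exp (-(2 * t)) = Real.exp (-t) * Real.exp (-t) := by
      rw [← Real.exp_add]
      ring_nf
    have hw' := (hw t ht.1.le).ne'
    have he := (Real.exp_pos (-t)).ne'
    refine hD.deriv.trans ?_
    rw [hgain, coagLoss_eq, harmSum t ht.1.le, he2]
    simp only [hc, Function.comp]
    field_simp
    ring

/-- well-posedness of the modified Smoluchowski equation with
limited aggregations: for every initial condition c₀ with 0 < ⟨c₀,a⟩ < ∞ there is
exactly one solution on [0,∞). -/
theorem stmt0
    (c₀ : ℕ → ℕ → ℝ) (h₀pos : ∀ a m : ℕ, 0 ≤ c₀ a m) (h₀mass : ∀ a : ℕ, c₀ a 0 = 0)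
    (h₀sum : Summable (fun p : ℕ × ℕ => (p.1 : ℝ) * c₀ p.1 p.2))
    (h₀arm : 0 < armSum c₀) :
    ∃ c : ℝ → ℕ → ℕ → ℝ, IsModifiedSmoluchowskiSolution c c₀ ∧
      ∀ c' : ℝ → ℕ → ℕ → ℝ, IsModifiedSmoluchowskiSolution c' c₀ →
        ∀ t ∈ Ici (0:ℝ), ∀ a m : ℕ, c' t a m = c t a m := by
  obtain ⟨c, hc⟩ := exists_isModifiedSmoluchowskiSolution h₀pos h₀mass h₀sum h₀arm
  exact ⟨c, hc, fun c' hc' t ht a m => hc'.unique hc h₀pos h₀mass ht a m⟩
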